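/- Let n ≥ 1, let λ ∈ [0,1], and let X and Y be independent ℝⁿ-valued random vectors, each having a probability density with respect to Lebesgue measure and finite differential entropy, and suppose √λ·X + √(1−λ)·Y has finite differential entropy. Then H(√λ·X + √(1−λ)·Y) ≥ λ·H(X) + (1−λ)·H(Y). -/

import Mathlib

open MeasureTheory ProbabilityTheory

/-- Differential entropy (in nats) of a random vector `X` with values in a measure space `E`
(here `E = ℝⁿ` with Lebesgue measure), defined via its probability density function:
`H(X) = -∫ f(x) ln f(x) dx`. -/
noncomputable def diffEntropy {Ω E : Type*} [MeasureSpace Ω] [MeasureSpace E]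
    (X : Ω → E) : ℝ :=
  -∫ x, (MeasureTheory.pdf X ℙ volume x).toReal *
      Real.log ((MeasureTheory.pdf X ℙ volume x).toReal)

section

open Set Filter Topology

theorem measurePreserving_rotation_gaussian {c s : ℝ} (hcs : c ^ 2 + s ^ 2 = 1) :
    MeasurePreserving (fun p : ℝ × ℝ ↦ (c * p.1 - s * p.2, s * p.1 + c * p.2))
      ((gaussianReal 0 1).prod (gaussianReal 0 1))
      ((gaussianReal 0 1).prod (gaussianReal 0 1)) := by
  refine ⟨by fun_prop, ?_⟩
  let A : ℝ × ℝ →L[ℝ] ℝ × ℝ :=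
    (c • ContinuousLinearMap.fst ℝ ℝ ℝ - s • ContinuousLinearMap.snd ℝ ℝ ℝ).prod
      (s • ContinuousLinearMap.fst ℝ ℝ ℝ + c • ContinuousLinearMap.snd ℝ ℝ ℝ)
  have hA : (fun p : ℝ × ℝ ↦ (c * p.1 - s * p.2, s * p.1 + c * p.2)) = A := by
    ext p <;> simp [A]
  have key : ∀ L : StrongDual ℝ ℝ, charFunDual (gaussianReal 0 1) L
      = Complex.exp (-((L 1 : ℝ) : ℂ) ^ 2 / 2) := by
    intro L
    have : ∀ v : ℝ, L v = inner ℝ v (L 1) := by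
      intro v
      have := L.map_smul v 1
      simp only [smul_eq_mul, mul_one] at this
      rw [this, RCLike.inner_apply, conj_trivial, mul_comm]
    have h2 : charFunDual (gaussianReal 0 1) L = charFun (gaussianReal 0 1) (L 1) := by
      rw [charFunDual_apply, charFun_apply]
      refine integral_congr_ae (ae_of_all _ fun v ↦ ?_)
      simp only []
      rw [this v]
    rw [h2, charFun_gaussianReal]
    simp [neg_div]
  rw [hA]
  apply Measure.ext_of_charFunDual
  ext L
  rw [charFunDual_map, charFunDual_prod, charFunDual_prod, key, key, key, key,
    ← Complex.exp_add, ← Complex.exp_add]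
  have e1 : A (1, 0) = c • ((1, 0) : ℝ × ℝ) + s • ((0, 1) : ℝ × ℝ) := by simp [A]
  have e2 : A (0, 1) = (-s) • ((1, 0) : ℝ × ℝ) + c • ((0, 1) : ℝ × ℝ) := by simp [A]
  simp only [ContinuousLinearMap.comp_apply, ContinuousLinearMap.inl_apply,
    ContinuousLinearMap.inr_apply, e1, e2, map_add, map_smul, smul_eq_mul]
  congr 1
  push_cast
  have : (c : ℂ) ^ 2 + (s : ℂ) ^ 2 = 1 := by exact_mod_cast hcs
  linear_combination (-(L (1, 0) : ℂ) ^ 2 / 2 - (L (0, 1) : ℂ) ^ 2 / 2) * this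

theorem Continuous.range_eq_Ioo_of_strictMono {F : ℝ → ℝ} {a b : ℝ} (hc : Continuous F)
    (hm : StrictMono F) (ha : Tendsto F atBot (𝓝 a)) (hb : Tendsto F atTop (𝓝 b)) :
    range F = Ioo a b := by
  apply Subset.antisymm
  · rintro _ ⟨x, rfl⟩
    exact ⟨(hm.monotone.le_of_tendsto ha (x - 1)).trans_lt (hm (by linarith)),
      (hm (by linarith : x < x + 1)).trans_le (hm.monotone.ge_of_tendsto hb (x + 1))⟩
  · rintro y ⟨h1, h2⟩
    obtain ⟨u, hu⟩ := (ha.eventually_lt_const h1).exists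
    obtain ⟨v, hv⟩ := (hb.eventually_const_lt h2).exists
    exact mem_range_of_exists_le_of_exists_ge hc ⟨u, hu.le⟩ ⟨v, hv.le⟩

theorem hasDerivAt_cdf_gaussianReal (u : ℝ) :
    HasDerivAt (cdf (gaussianReal 0 1)) (gaussianPDFReal 0 1 u) u := by
  have hcont : Continuous (gaussianPDFReal 0 1) := by
    unfold gaussianPDFReal; fun_prop
  have h : ∀ x, cdf (gaussianReal 0 1) x
      = cdf (gaussianReal 0 1) 0 + ∫ t in (0 : ℝ)..x, gaussianPDFReal 0 1 t := by
    have h1 : ∀ x, cdf (gaussianReal 0 1) x = ∫ t in Iic x, gaussianPDFReal 0 1 t := by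
      intro x
      rw [cdf_eq_real, measureReal_def, gaussianReal_apply_eq_integral _ one_ne_zero,
        ENNReal.toReal_ofReal (integral_nonneg fun _ ↦ gaussianPDFReal_nonneg _ _ _)]
    intro x
    rw [h1, h1, ← intervalIntegral.integral_Iic_sub_Iic]
    · ring
    all_goals exact (integrable_gaussianPDFReal 0 1).integrableOn
  rw [show (cdf (gaussianReal 0 1) : ℝ → ℝ) = _ from funext h]
  exact (intervalIntegral.integral_hasDerivAt_right (hcont.intervalIntegrable _ _)
    (hcont.stronglyMeasurableAtFilter _ _) hcont.continuousAt).const_add _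

theorem range_cdf_gaussianReal : range (cdf (gaussianReal 0 1)) = Ioo 0 1 := by
  refine Continuous.range_eq_Ioo_of_strictMono ?_ ?_ (tendsto_cdf_atBot _) (tendsto_cdf_atTop _)
  · exact continuous_iff_continuousAt.2 fun u ↦ (hasDerivAt_cdf_gaussianReal u).continuousAt
  · refine strictMono_of_deriv_pos fun u ↦ ?_
    rw [(hasDerivAt_cdf_gaussianReal u).deriv]
    exact gaussianPDFReal_pos _ _ _ one_ne_zero

theorem exists_gaussian_transport {f : ℝ → ℝ} (hf : Continuous f) {δ R : ℝ} (hδ : 0 < δ)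
    (hδf : ∀ x, δ ≤ f x) (hR : 0 < R) :
    ∃ T : ℝ → ℝ, (∀ u, HasDerivAt T
      ((∫ x in Icc (-R) R, f x) * gaussianPDFReal 0 1 u / f (T u)) u) ∧
      range T = Ioo (-R) R := by
  have hpos : ∀ x, 0 < f x := fun x ↦ hδ.trans_le (hδf x)
  let F : ℝ → ℝ := fun x ↦ ∫ t in (-R)..x, f t
  have hF : ∀ x, HasDerivAt F (f x) x := fun x ↦
    intervalIntegral.integral_hasDerivAt_right (hf.intervalIntegrable _ _)
      (hf.stronglyMeasurableAtFilter _ _) hf.continuousAt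
  have hFc : Continuous F := continuous_iff_continuousAt.2 fun u ↦ (hF u).continuousAt
  have hFm : StrictMono F := strictMono_of_deriv_pos fun u ↦ by
    rw [(hF u).deriv]; exact hpos u
  have hG : Monotone (fun x ↦ F x - δ * x) := by
    have hd : ∀ x, HasDerivAt (fun x ↦ F x - δ * x) (f x - δ * 1) x := fun x ↦
      (hF x).sub ((hasDerivAt_id x).const_mul δ)
    refine monotone_of_deriv_nonneg (fun x ↦ (hd x).differentiableAt) fun x ↦ ?_
    rw [(hd x).deriv]
    linarith [hδf x]
  have hFs : Function.Surjective F := by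
    intro y
    have hlin : ∀ y' : ℝ, δ * (y' / δ) = y' := fun y' ↦ by field_simp
    refine mem_range_of_exists_le_of_exists_ge hFc
      ⟨min 0 ((y - F 0) / δ), ?_⟩ ⟨max 0 ((y - F 0) / δ), ?_⟩
    · have h1 := hG (min_le_left 0 ((y - F 0) / δ))
      have h2 := mul_le_mul_of_nonneg_left (min_le_right 0 ((y - F 0) / δ)) hδ.le
      rw [hlin] at h2
      simp only [mul_zero] at h1
      linarith
    · have h1 := hG (le_max_left 0 ((y - F 0) / δ))
      have h2 := mul_le_mul_of_nonneg_left (le_max_right 0 ((y - F 0) / δ)) hδ.le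
      rw [hlin] at h2
      simp only [mul_zero] at h1
      linarith
  let e := hFm.orderIsoOfSurjective F hFs
  have heF : ∀ y, F (e.symm y) = y := fun y ↦ e.apply_symm_apply y
  set a := ∫ x in Icc (-R) R, f x with ha
  have haF : F R = a := by
    simp only [F]
    rw [intervalIntegral.integral_of_le (by linarith), ha, integral_Icc_eq_integral_Ioc]
  have hF0 : F (-R) = 0 := by simp [F]
  have ha0 : 0 < a := by rw [← haF, ← hF0]; exact hFm (by linarith)
  refine ⟨fun u ↦ e.symm (a * cdf (gaussianReal 0 1) u), fun u ↦ ?_, ?_⟩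
  · have h1 : HasDerivAt e.symm (f (e.symm (a * cdf (gaussianReal 0 1) u)))⁻¹
        (a * cdf (gaussianReal 0 1) u) :=
      HasDerivAt.of_local_left_inverse (f := F) e.symm.continuous.continuousAt (hF _)
        (hpos _).ne' (Eventually.of_forall heF)
    have h2 := h1.comp u ((hasDerivAt_cdf_gaussianReal u).const_mul a)
    rw [mul_comm, ← div_eq_mul_inv] at h2
    exact h2
  · ext x
    constructor
    · rintro ⟨u, rfl⟩
      have hu : cdf (gaussianReal 0 1) u ∈ Ioo (0 : ℝ) 1 := range_cdf_gaussianReal ▸ ⟨u, rfl⟩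
      constructor
      · rw [← hFm.lt_iff_lt, heF, hF0]
        exact mul_pos ha0 hu.1
      · rw [← hFm.lt_iff_lt, heF, haF]
        nlinarith [hu.2]
    · rintro ⟨h1, h2⟩
      have : F x / a ∈ Ioo (0 : ℝ) 1 := by
        constructor
        · exact div_pos (hF0 ▸ hFm h1) ha0
        · rw [div_lt_one ha0, ← haF]
          exact hFm h2
      rw [← range_cdf_gaussianReal] at this
      obtain ⟨u, hu⟩ := this
      refine ⟨u, ?_⟩
      simp only [hu]
      rw [mul_div_cancel₀ _ ha0.ne']
      exact e.symm_apply_apply x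

theorem setIntegral_mul_eq_integral_gaussian {f T : ℝ → ℝ} {a R : ℝ} (hpos : ∀ x, 0 < f x)
    (ha : 0 < a) (hT : ∀ u, HasDerivAt T (a * gaussianPDFReal 0 1 u / f (T u)) u)
    (hrange : range T = Ioo (-R) R) (ψ : ℝ → ℝ) :
    ∫ x in Icc (-R) R, f x * ψ x = a * ∫ u, ψ (T u) ∂(gaussianReal 0 1) := by
  have hT' : ∀ u, 0 < a * gaussianPDFReal 0 1 u / f (T u) := fun u ↦
    div_pos (mul_pos ha (gaussianPDFReal_pos _ _ _ one_ne_zero)) (hpos _)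
  have hm : StrictMono T := strictMono_of_deriv_pos fun u ↦ by
    rw [(hT u).deriv]; exact hT' u
  rw [integral_Icc_eq_integral_Ioo, ← hrange, ← image_univ,
    integral_image_eq_integral_abs_deriv_smul MeasurableSet.univ
      (fun u _ ↦ (hT u).hasDerivWithinAt) hm.injective.injOn, setIntegral_univ,
    integral_gaussianReal_eq_integral_smul one_ne_zero, ← integral_const_mul]
  refine integral_congr_ae (ae_of_all _ fun u ↦ ?_)
  simp only [smul_eq_mul, abs_of_pos (hT' u)]
  have := (hpos (T u)).ne'
  field_simp

theorem continuous_gaussianPDFReal (μ : ℝ) (v : NNReal) : Continuous (gaussianPDFReal μ v) := by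
  unfold gaussianPDFReal
  fun_prop

theorem integrable_log_gaussianPDFReal :
    Integrable (fun u ↦ Real.log (gaussianPDFReal 0 1 u)) (gaussianReal 0 1) := by
  have h : ∀ u, Real.log (gaussianPDFReal 0 1 u) = Real.log (√(2 * Real.pi))⁻¹ - u ^ 2 / 2 := by
    intro u
    rw [gaussianPDFReal, Real.log_mul (by positivity) (Real.exp_ne_zero _), Real.log_exp]
    simp; ring
  simp_rw [h]
  exact (integrable_const _).sub ((memLp_id_gaussianReal 2).integrable_sq.div_const 2)

theorem lintegral_gaussian_pushforward_le {Θ D g : ℝ → ℝ} {S : Set ℝ}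
    (hΘ : ∀ s, HasDerivAt Θ (D s) s) (hD : ∀ s, 0 < D s) (hS : range Θ ⊆ S) :
    ∫⁻ s, ENNReal.ofReal (g (Θ s) * D s / gaussianPDFReal 0 1 s) ∂(gaussianReal 0 1)
      ≤ ∫⁻ z in S, ENNReal.ofReal (g z) := by
  have hm : StrictMono Θ := strictMono_of_deriv_pos fun u ↦ by
    rw [(hΘ u).deriv]; exact hD u
  refine le_trans (le_of_eq ?_) (lintegral_mono_set hS)
  rw [← image_univ, lintegral_image_eq_lintegral_abs_deriv_mul MeasurableSet.univ
      (fun u _ ↦ (hΘ u).hasDerivWithinAt) hm.injective.injOn, setLIntegral_univ,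
      gaussianReal_of_var_ne_zero _ one_ne_zero,
      lintegral_withDensity_eq_lintegral_mul_non_measurable _ (measurable_gaussianPDF _ _)
        (ae_of_all _ fun _ ↦ ENNReal.ofReal_lt_top)]
  refine lintegral_congr fun s ↦ ?_
  have h0 := gaussianPDFReal_pos 0 1 s one_ne_zero
  rw [Pi.mul_apply, gaussianPDF, ← ENNReal.ofReal_mul h0.le, abs_of_pos (hD s),
    ← ENNReal.ofReal_mul (hD s).le]
  congr 1
  field_simp

theorem log_deriv_comb_le {c s x y φ₀ φ₁ φ₂ a b p q g G : ℝ} (hcs : c ^ 2 + s ^ 2 = 1)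
    (hx : x = a * φ₁ / p) (hy : y = b * φ₂ / q)
    (h0 : 0 < φ₀) (h1 : 0 < φ₁) (h2 : 0 < φ₂) (ha : 0 < a) (hb : 0 < b) (hp : 0 < p) (hq : 0 < q)
    (hg : 0 < g) (hG : 0 < G) :
    Real.log g ≤ Real.log G + Real.log φ₀
      - c ^ 2 * (Real.log a + Real.log φ₁ - Real.log p)
      - s ^ 2 * (Real.log b + Real.log φ₂ - Real.log q)
      + (g * (c ^ 2 * x + s ^ 2 * y) / φ₀ / G - 1) := by
  have hx0 : 0 < x := by rw [hx]; positivity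
  have hy0 : 0 < y := by rw [hy]; positivity
  have hlx : Real.log x = Real.log a + Real.log φ₁ - Real.log p := by
    rw [hx, Real.log_div (by positivity) hp.ne', Real.log_mul ha.ne' h1.ne']
  have hly : Real.log y = Real.log b + Real.log φ₂ - Real.log q := by
    rw [hy, Real.log_div (by positivity) hq.ne', Real.log_mul hb.ne' h2.ne']
  rw [← hlx, ← hly]
  have hconc : c ^ 2 * Real.log x + s ^ 2 * Real.log y ≤ Real.log (c ^ 2 * x + s ^ 2 * y) :=
    strictConcaveOn_log_Ioi.concaveOn.2 hx0 hy0 (sq_nonneg _) (sq_nonneg _) hcs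
  have hm : min x y ≤ c ^ 2 * x + s ^ 2 * y := by
    have e : min x y = c ^ 2 * min x y + s ^ 2 * min x y := by rw [← add_mul, hcs, one_mul]
    rw [e]
    gcongr
    · exact min_le_left _ _
    · exact min_le_right _ _
  have hD : 0 < c ^ 2 * x + s ^ 2 * y := (lt_min hx0 hy0).trans_le hm
  have hl := Real.log_le_sub_one_of_pos (show 0 < g * (c ^ 2 * x + s ^ 2 * y) / φ₀ / G by positivity)
  rw [Real.log_div (by positivity) hG.ne', Real.log_div (by positivity) h0.ne',
    Real.log_mul hg.ne' hD.ne'] at hl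
  linarith

theorem entropy_ineq_interval_of_continuous {c s : ℝ} (hc : 0 ≤ c) (hs : 0 ≤ s)
    (hcs : c ^ 2 + s ^ 2 = 1) {f h g : ℝ → ℝ} {δ C ε M R : ℝ} (hδ : 0 < δ) (hε : 0 < ε)
    (hR : 0 < R) (hf : Continuous f) (hh : Continuous h) (hg : Measurable g)
    (hfδ : ∀ x, δ ≤ f x) (hfC : ∀ x, f x ≤ C) (hhδ : ∀ x, δ ≤ h x) (hhC : ∀ x, h x ≤ C)
    (hgε : ∀ x, ε ≤ g x) (hgM : ∀ x, g x ≤ M) :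
    ∫ x in Icc (-R) R, ∫ y in Icc (-R) R, f x * h y * Real.log (g (c * x + s * y))
      ≤ c ^ 2 * (∫ y in Icc (-R) R, h y) * (∫ x in Icc (-R) R, f x * Real.log (f x))
        + s ^ 2 * (∫ x in Icc (-R) R, f x) * (∫ y in Icc (-R) R, h y * Real.log (h y))
        + (∫ x in Icc (-R) R, f x) * (∫ y in Icc (-R) R, h y)
          * Real.log (∫ z in Icc (-(2 * R)) (2 * R), g z)
        - c ^ 2 * (∫ y in Icc (-R) R, h y)
          * ((∫ x in Icc (-R) R, f x) * Real.log (∫ x in Icc (-R) R, f x))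
        - s ^ 2 * (∫ x in Icc (-R) R, f x)
          * ((∫ y in Icc (-R) R, h y) * Real.log (∫ y in Icc (-R) R, h y)) := by
  have hfp : ∀ x, 0 < f x := fun x ↦ hδ.trans_le (hfδ x)
  have hhp : ∀ x, 0 < h x := fun x ↦ hδ.trans_le (hhδ x)
  have hgp : ∀ x, 0 < g x := fun x ↦ hε.trans_le (hgε x)
  have hφ : ∀ u, 0 < gaussianPDFReal 0 1 u := fun u ↦ gaussianPDFReal_pos _ _ u one_ne_zero
  obtain ⟨T, hT, hTr⟩ := exists_gaussian_transport hf hδ hfδ hR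
  obtain ⟨U, hU, hUr⟩ := exists_gaussian_transport hh hδ hhδ hR
  have hposint : ∀ {k : ℝ → ℝ} {η r : ℝ}, 0 < η → 0 < r → Measurable k → (∀ x, η ≤ k x) →
      (∃ B, ∀ x, k x ≤ B) → 0 < ∫ x in Icc (-r) r, k x := by
    rintro k η r hη hr hk hηk ⟨B, hB⟩
    have h1 : ∫ x in Icc (-r) r, η ≤ ∫ x in Icc (-r) r, k x := by
      refine integral_mono (integrable_const _) ?_ hηk
      refine Integrable.of_bound hk.aestronglyMeasurable B (ae_of_all _ fun x ↦ ?_)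
      rw [Real.norm_of_nonneg (hη.le.trans (hηk x))]
      exact hB x
    refine lt_of_lt_of_le ?_ h1
    rw [setIntegral_const, smul_eq_mul, Real.volume_real_Icc_of_le (by linarith)]
    exact mul_pos (by linarith) hη
  set a := ∫ x in Icc (-R) R, f x with ha_def
  set b := ∫ y in Icc (-R) R, h y with hb_def
  set G := ∫ z in Icc (-(2 * R)) (2 * R), g z with hG_def
  have ha : 0 < a := hposint hδ hR hf.measurable hfδ ⟨C, hfC⟩
  have hb : 0 < b := hposint hδ hR hh.measurable hhδ ⟨C, hhC⟩
  have hG : 0 < G := hposint hε (by linarith) hg hgε ⟨M, hgM⟩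
  set γ := gaussianReal 0 1 with hγ
  have hTc : Continuous T := continuous_iff_continuousAt.2 fun u ↦ (hT u).continuousAt
  have hUc : Continuous U := continuous_iff_continuousAt.2 fun u ↦ (hU u).continuousAt
  have hφc := continuous_gaussianPDFReal 0 1
  have bddlog : ∀ {α : Type} [MeasurableSpace α] (μ : Measure α) [IsFiniteMeasure μ] (k : α → ℝ)
      (η B : ℝ), 0 < η → Measurable k → (∀ x, η ≤ k x) → (∀ x, k x ≤ B) →
      Integrable (fun x ↦ Real.log (k x)) μ := by
    intro α _ μ _ k η B hη hk h1 h2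
    refine Integrable.of_mem_Icc (Real.log η) (Real.log B) hk.log.aemeasurable
      (ae_of_all _ fun x ↦ ⟨Real.log_le_log hη (h1 x), Real.log_le_log (hη.trans_le (h1 x)) (h2 x)⟩)
  have rot := measurePreserving_rotation_gaussian hcs
  set ρ : ℝ × ℝ → ℝ × ℝ := fun p ↦ (c * p.1 - s * p.2, s * p.1 + c * p.2) with hρ
  have fstmp : MeasurePreserving (fun p : ℝ × ℝ ↦ (ρ p).1) (γ.prod γ) γ :=
    measurePreserving_fst.comp rot
  have sndmp : MeasurePreserving (fun p : ℝ × ℝ ↦ (ρ p).2) (γ.prod γ) γ :=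
    measurePreserving_snd.comp rot
  have compint : ∀ {π : ℝ × ℝ → ℝ}, MeasurePreserving π (γ.prod γ) γ → ∀ {k : ℝ → ℝ},
      Integrable k γ → Integrable (fun p ↦ k (π p)) (γ.prod γ) ∧
        ∫ p, k (π p) ∂(γ.prod γ) = ∫ u, k u ∂γ := by
    intro π hπ k hk
    refine ⟨hπ.integrable_comp_of_integrable hk, ?_⟩
    have hk' : AEStronglyMeasurable k ((γ.prod γ).map π) := by
      rw [hπ.map_eq]
      exact hk.aestronglyMeasurable
    rw [← integral_map hπ.aemeasurable hk', hπ.map_eq]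
  have lhs : ∫ x in Icc (-R) R, ∫ y in Icc (-R) R, f x * h y * Real.log (g (c * x + s * y))
      = a * b * ∫ p, Real.log (g (c * T (ρ p).1 + s * U (ρ p).2)) ∂(γ.prod γ) := by
    have h1 : ∀ x, ∫ y in Icc (-R) R, f x * h y * Real.log (g (c * x + s * y))
        = f x * (b * ∫ v, Real.log (g (c * x + s * U v)) ∂γ) := by
      intro x
      rw [← setIntegral_mul_eq_integral_gaussian hhp hb hU hUr
        (fun y ↦ Real.log (g (c * x + s * y))), ← integral_const_mul]
      simp_rw [mul_assoc]
    simp_rw [h1]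
    rw [setIntegral_mul_eq_integral_gaussian hfp ha hT hTr, integral_const_mul, ← mul_assoc]
    congr 1
    rw [← integral_prod (fun p : ℝ × ℝ ↦ Real.log (g (c * T p.1 + s * U p.2)))]
    · rw [← rot.map_eq, integral_map rot.aemeasurable]
      · rw [rot.map_eq]
      · exact (hg.comp (by fun_prop)).log.aestronglyMeasurable
    · exact bddlog _ _ ε M hε (hg.comp (by fun_prop)) (fun _ ↦ hgε _) (fun _ ↦ hgM _)
  set D : ℝ × ℝ → ℝ := fun p ↦ c ^ 2 * (a * gaussianPDFReal 0 1 (ρ p).1 / f (T (ρ p).1))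
    + s ^ 2 * (b * gaussianPDFReal 0 1 (ρ p).2 / h (U (ρ p).2)) with hD_def
  have hDpos : ∀ p, 0 < D p := by
    intro p
    have h1 : 0 < a * gaussianPDFReal 0 1 (ρ p).1 / f (T (ρ p).1) :=
      div_pos (mul_pos ha (hφ _)) (hfp _)
    have h2 : 0 < b * gaussianPDFReal 0 1 (ρ p).2 / h (U (ρ p).2) :=
      div_pos (mul_pos hb (hφ _)) (hhp _)
    rcases hc.eq_or_lt with h0 | h0
    · have : s ^ 2 = 1 := by rw [← hcs, ← h0]; ring
      simp only [hD_def, this, ← h0]; linarith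
    · simp only [hD_def]; positivity
  have hDc : Measurable D := by
    have m1 : Measurable (fun p ↦ gaussianPDFReal 0 1 (ρ p).1) := hφc.measurable.comp (by fun_prop)
    have m2 : Measurable (fun p ↦ gaussianPDFReal 0 1 (ρ p).2) := hφc.measurable.comp (by fun_prop)
    have m3 : Measurable (fun p ↦ f (T (ρ p).1)) := (hf.comp hTc).measurable.comp (by fun_prop)
    have m4 : Measurable (fun p ↦ h (U (ρ p).2)) := (hh.comp hUc).measurable.comp (by fun_prop)
    exact (((m1.const_mul a).div m3).const_mul _).add (((m2.const_mul b).div m4).const_mul _)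
  set Θ : ℝ × ℝ → ℝ := fun p ↦ c * T (ρ p).1 + s * U (ρ p).2 with hΘ_def
  have hΘc : Continuous Θ := by simp only [hΘ_def, hρ]; fun_prop
  have hc1 : c ≤ 1 := by nlinarith
  have hs1 : s ≤ 1 := by nlinarith
  set q : ℝ × ℝ → ℝ := fun p ↦ g (Θ p) * D p / gaussianPDFReal 0 1 p.1 with hq_def
  have hqm : Measurable q :=
    ((hg.comp hΘc.measurable).mul hDc).div (hφc.measurable.comp measurable_fst)
  have hq0 : ∀ p, 0 ≤ q p := fun p ↦ div_nonneg (mul_nonneg (hgp _).le (hDpos _).le) (hφ _).le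
  have hql : ∫⁻ p, ENNReal.ofReal (q p) ∂(γ.prod γ) ≤ ENNReal.ofReal G := by
    rw [lintegral_prod_symm _ hqm.ennreal_ofReal.aemeasurable]
    have hGl : ENNReal.ofReal G = ∫⁻ z in Icc (-(2 * R)) (2 * R), ENNReal.ofReal (g z) := by
      refine ofReal_integral_eq_lintegral_ofReal ?_ (ae_of_all _ fun z ↦ (hgp z).le)
      exact Integrable.of_mem_Icc ε M hg.aemeasurable (ae_of_all _ fun x ↦ ⟨hgε x, hgM x⟩)
    rw [hGl]
    refine (lintegral_mono (g := fun _ ↦ ∫⁻ z in Icc (-(2 * R)) (2 * R), ENNReal.ofReal (g z))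
      fun t ↦ ?_).trans (by simp)
    refine lintegral_gaussian_pushforward_le (Θ := fun r ↦ Θ (r, t)) (D := fun r ↦ D (r, t))
      (fun r ↦ ?_) (fun r ↦ hDpos _) ?_
    · have d1 : HasDerivAt (fun r ↦ c * r - s * t) c r := by
        simpa using ((hasDerivAt_id r).const_mul c).sub_const (s * t)
      have d2 : HasDerivAt (fun r ↦ s * r + c * t) s r := by
        simpa using ((hasDerivAt_id r).const_mul s).add_const (c * t)
      refine ((((hT _).comp r d1).const_mul c).add
        (((hU _).comp r d2).const_mul s)).congr_deriv ?_
      simp only [hD_def, hρ]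
      ring
    · rintro _ ⟨r, rfl⟩
      have t1 : T (ρ (r, t)).1 ∈ Ioo (-R) R := hTr ▸ mem_range_self _
      have t2 : U (ρ (r, t)).2 ∈ Ioo (-R) R := hUr ▸ mem_range_self _
      have := t1.1; have := t1.2; have := t2.1; have := t2.2
      simp only [hΘ_def]
      constructor <;> nlinarith
  have hqi : Integrable q (γ.prod γ) :=
    (lintegral_ofReal_ne_top_iff_integrable hqm.aestronglyMeasurable (ae_of_all _ hq0)).1
      (hql.trans_lt ENNReal.ofReal_lt_top).ne
  have hqG : ∫ p, q p ∂(γ.prod γ) ≤ G := by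
    rw [integral_eq_lintegral_of_nonneg_ae (ae_of_all _ hq0) hqm.aestronglyMeasurable]
    exact ENNReal.toReal_le_of_le_ofReal hG.le hql
  have hφ0 := compint measurePreserving_fst integrable_log_gaussianPDFReal
  have hφ1 := compint fstmp integrable_log_gaussianPDFReal
  have hφ2 := compint sndmp integrable_log_gaussianPDFReal
  have hf1 := compint fstmp (bddlog γ (fun u ↦ f (T u)) δ C hδ (hf.comp hTc).measurable
    (fun _ ↦ hfδ _) (fun _ ↦ hfC _))
  have hh1 := compint sndmp (bddlog γ (fun u ↦ h (U u)) δ C hδ (hh.comp hUc).measurable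
    (fun _ ↦ hhδ _) (fun _ ↦ hhC _))
  have hfA := setIntegral_mul_eq_integral_gaussian hfp ha hT hTr (fun x ↦ Real.log (f x))
  have hhB := setIntegral_mul_eq_integral_gaussian hhp hb hU hUr (fun x ↦ Real.log (h x))
  have i1 : Integrable (fun p ↦ Real.log a + Real.log (gaussianPDFReal 0 1 (ρ p).1)
      - Real.log (f (T (ρ p).1))) (γ.prod γ) := ((integrable_const _).add hφ1.1).sub hf1.1
  have i2 : Integrable (fun p ↦ Real.log b + Real.log (gaussianPDFReal 0 1 (ρ p).2)
      - Real.log (h (U (ρ p).2))) (γ.prod γ) := ((integrable_const _).add hφ2.1).sub hh1.1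
  have i0 : Integrable (fun p : ℝ × ℝ ↦ Real.log G + Real.log (gaussianPDFReal 0 1 p.1))
      (γ.prod γ) := (integrable_const _).add hφ0.1
  have iq : Integrable (fun p ↦ q p / G - 1) (γ.prod γ) :=
    (hqi.div_const _).sub (integrable_const _)
  have i01 : Integrable (fun p ↦ Real.log G + Real.log (gaussianPDFReal 0 1 p.1)
      - c ^ 2 * (Real.log a + Real.log (gaussianPDFReal 0 1 (ρ p).1)
        - Real.log (f (T (ρ p).1)))) (γ.prod γ) := i0.sub (i1.const_mul _)
  have i02 : Integrable (fun p ↦ Real.log G + Real.log (gaussianPDFReal 0 1 p.1)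
      - c ^ 2 * (Real.log a + Real.log (gaussianPDFReal 0 1 (ρ p).1)
        - Real.log (f (T (ρ p).1)))
      - s ^ 2 * (Real.log b + Real.log (gaussianPDFReal 0 1 (ρ p).2)
        - Real.log (h (U (ρ p).2)))) (γ.prod γ) := i01.sub (i2.const_mul _)
  have main : ∫ p, Real.log (g (Θ p)) ∂(γ.prod γ)
      ≤ ∫ p, (Real.log G + Real.log (gaussianPDFReal 0 1 p.1)
          - c ^ 2 * (Real.log a + Real.log (gaussianPDFReal 0 1 (ρ p).1)
            - Real.log (f (T (ρ p).1)))
          - s ^ 2 * (Real.log b + Real.log (gaussianPDFReal 0 1 (ρ p).2)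
            - Real.log (h (U (ρ p).2)))
          + (q p / G - 1)) ∂(γ.prod γ) :=
    integral_mono (bddlog _ _ ε M hε (hg.comp hΘc.measurable) (fun _ ↦ hgε _) (fun _ ↦ hgM _))
      (i02.add iq) fun p ↦
        log_deriv_comb_le hcs rfl rfl (hφ _) (hφ _) (hφ _) ha hb (hfp _) (hhp _) (hgp _) hG
  rw [integral_add i02 iq, integral_sub i01 (i2.const_mul _), integral_sub i0 (i1.const_mul _),
    integral_add (integrable_const _) hφ0.1, integral_const_mul, integral_const_mul,
    integral_sub (by exact (integrable_const _).add hφ1.1) hf1.1,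
    integral_sub (by exact (integrable_const _).add hφ2.1) hh1.1,
    integral_add (integrable_const _) hφ1.1, integral_add (integrable_const _) hφ2.1,
    integral_sub (hqi.div_const _) (integrable_const _), integral_div,
    hφ0.2, hφ1.2, hφ2.2, hf1.2, hh1.2] at main
  simp only [integral_const, probReal_univ, one_smul] at main
  have hqG1 : (∫ p, q p ∂(γ.prod γ)) / G ≤ 1 := (div_le_one hG).2 hqG
  rw [lhs, hfA, hhB]
  set K := ∫ u, Real.log (gaussianPDFReal 0 1 u) ∂γ
  set A := ∫ u, Real.log (f (T u)) ∂γ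
  set B := ∫ u, Real.log (h (U u)) ∂γ
  have hfin : ∫ p, Real.log (g (Θ p)) ∂(γ.prod γ) ≤ Real.log G
      - c ^ 2 * (Real.log a - A) - s ^ 2 * (Real.log b - B) := by
    have : K = c ^ 2 * K + s ^ 2 * K := by rw [← add_mul, hcs, one_mul]
    linarith
  have := mul_le_mul_of_nonneg_left hfin (mul_pos ha hb).le
  linarith

/-- A real function that is measurable and bounded. -/
def BddMeasurable {A : Type*} [MeasurableSpace A] (f : A → ℝ) : Prop :=
  Measurable f ∧ ∃ C, ∀ x, |f x| ≤ C

namespace BddMeasurable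

variable {A B : Type*} [MeasurableSpace A] [MeasurableSpace B] {f g : A → ℝ}

theorem integrable (hf : BddMeasurable f) (μ : Measure A) [IsFiniteMeasure μ] :
    Integrable f μ := by
  obtain ⟨hm, C, hC⟩ := hf
  exact Integrable.of_bound hm.aestronglyMeasurable C (ae_of_all _ hC)

theorem mul (hf : BddMeasurable f) (hg : BddMeasurable g) :
    BddMeasurable fun x ↦ f x * g x := by
  obtain ⟨hf, C, hC⟩ := hf
  obtain ⟨hg, D, hD⟩ := hg
  refine ⟨hf.mul hg, C * D, fun x ↦ ?_⟩
  rw [abs_mul]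
  exact mul_le_mul (hC x) (hD x) (abs_nonneg _) ((abs_nonneg _).trans (hC x))

theorem comp (hf : BddMeasurable f) {e : B → A} (he : Measurable e) :
    BddMeasurable fun x ↦ f (e x) :=
  ⟨hf.1.comp he, hf.2.imp fun _ h x ↦ h (e x)⟩

theorem mul_log (hf : BddMeasurable f) : BddMeasurable fun x ↦ f x * Real.log (f x) := by
  obtain ⟨hf, C, hC⟩ := hf
  refine ⟨hf.mul hf.log, ?_⟩
  obtain ⟨D, hD⟩ := (isCompact_Icc (a := -C) (b := C)).exists_bound_of_continuousOn
    Real.continuous_mul_log.continuousOn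
  exact ⟨D, fun x ↦ hD _ (abs_le.1 (hC x))⟩

theorem log (hg : BddMeasurable g) (hpos : ∃ ε > 0, ∀ x, ε ≤ g x) :
    BddMeasurable fun x ↦ Real.log (g x) := by
  obtain ⟨hg, C, hC⟩ := hg
  obtain ⟨ε, hε, h⟩ := hpos
  refine ⟨hg.log, max |Real.log ε| |Real.log C|, fun x ↦ ?_⟩
  exact abs_le_max_abs_abs (Real.log_le_log hε (h x))
    (Real.log_le_log (hε.trans_le (h x)) ((le_abs_self _).trans (hC x)))

theorem integral {f : A × B → ℝ} (hf : BddMeasurable f) (ν : Measure B) [IsFiniteMeasure ν] :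
    BddMeasurable fun x ↦ ∫ y, f (x, y) ∂ν := by
  obtain ⟨hf, C, hC⟩ := hf
  refine ⟨hf.stronglyMeasurable.integral_prod_right'.measurable, C * ν.real univ, fun x ↦ ?_⟩
  rw [← Real.norm_eq_abs]
  exact norm_integral_le_of_norm_le_const (ae_of_all _ fun y ↦ hC (x, y))

end BddMeasurable

/-- The homogeneous functional form of the entropy power inequality for the combination map `m`
with weights `u`, `v`, tested on bounded measurable functions. -/
def EntropyIneq {A B C : Type*} [MeasurableSpace A] [MeasurableSpace B] [MeasurableSpace C]
    (u v : ℝ) (α : Measure A) (β : Measure B) (γ : Measure C) (m : A → B → C) : Prop :=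
  ∀ (f : A → ℝ) (h : B → ℝ) (g : C → ℝ), BddMeasurable f → BddMeasurable h → BddMeasurable g →
    (∀ x, 0 ≤ f x) → (∀ y, 0 ≤ h y) → (∃ ε > 0, ∀ z, ε ≤ g z) →
    ∫ x, ∫ y, f x * h y * Real.log (g (m x y)) ∂β ∂α
      ≤ u * (∫ y, h y ∂β) * (∫ x, f x * Real.log (f x) ∂α)
        + v * (∫ x, f x ∂α) * (∫ y, h y * Real.log (h y) ∂β)
        + (∫ x, f x ∂α) * (∫ y, h y ∂β) * Real.log (∫ z, g z ∂γ)
        - u * (∫ y, h y ∂β) * ((∫ x, f x ∂α) * Real.log (∫ x, f x ∂α))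
        - v * (∫ x, f x ∂α) * ((∫ y, h y ∂β) * Real.log (∫ y, h y ∂β))

namespace EntropyIneq

variable {A B C A' B' C' : Type*} [MeasurableSpace A] [MeasurableSpace B] [MeasurableSpace C]
  [MeasurableSpace A'] [MeasurableSpace B'] [MeasurableSpace C'] {u v : ℝ}
  {α : Measure A} {β : Measure B} {γ : Measure C}
  {α' : Measure A'} {β' : Measure B'} {γ' : Measure C'} {m : A → B → C} {m' : A' → B' → C'}

theorem of_measurableEquiv (H : EntropyIneq u v α' β' γ' m') (eA : A ≃ᵐ A') (eB : B ≃ᵐ B')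
    (eC : C ≃ᵐ C') (hA : MeasurePreserving eA α α') (hB : MeasurePreserving eB β β')
    (hC : MeasurePreserving eC γ γ') (hm : ∀ x y, eC (m x y) = m' (eA x) (eB y)) :
    EntropyIneq u v α β γ m := by
  intro f h g hf hh hg hf0 hh0 ⟨ε, hε, hgε⟩
  have key := H (fun x ↦ f (eA.symm x)) (fun x ↦ h (eB.symm x)) (fun x ↦ g (eC.symm x))
    (hf.comp eA.symm.measurable) (hh.comp eB.symm.measurable) (hg.comp eC.symm.measurable)
    (fun _ ↦ hf0 _) (fun _ ↦ hh0 _) ⟨ε, hε, fun _ ↦ hgε _⟩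
  have kA : ∀ k : A' → ℝ, ∫ x, k x ∂α' = ∫ x, k (eA x) ∂α := fun k ↦ (hA.integral_comp' k).symm
  have kB : ∀ k : B' → ℝ, ∫ x, k x ∂β' = ∫ x, k (eB x) ∂β := fun k ↦ (hB.integral_comp' k).symm
  have kC : ∀ k : C' → ℝ, ∫ x, k x ∂γ' = ∫ x, k (eC x) ∂γ := fun k ↦ (hC.integral_comp' k).symm
  simp only [kA, kB, kC, ← hm, MeasurableEquiv.symm_apply_apply] at key
  exact key

theorem prod [IsFiniteMeasure α] [IsFiniteMeasure β] [IsFiniteMeasure γ] [IsFiniteMeasure α']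
    [IsFiniteMeasure β'] [IsFiniteMeasure γ'] (hγ' : γ' ≠ 0)
    (hm : Measurable (Function.uncurry m)) (hm' : Measurable (Function.uncurry m'))
    (H : EntropyIneq u v α β γ m) (H' : EntropyIneq u v α' β' γ' m') :
    EntropyIneq u v (α.prod α') (β.prod β') (γ.prod γ')
      (fun p q ↦ (m p.1 q.1, m' p.2 q.2)) := by
  intro f h g hf hh hg hf0 hh0 ⟨ε, hε, hgε⟩
  have hlog := hg.log ⟨ε, hε, hgε⟩
  have hmm : Measurable fun p : ((A × B) × A') × B' ↦ (m p.1.1.1 p.1.1.2, m' p.1.2 p.2) :=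
    (hm.comp (measurable_fst.comp measurable_fst)).prodMk
      (hm'.comp ((measurable_snd.comp measurable_fst).prodMk measurable_snd))
  have hF : BddMeasurable fun p : ((A × B) × A') × B' ↦ f (p.1.1.1, p.1.2) * h (p.1.1.2, p.2) *
      Real.log (g (m p.1.1.1 p.1.1.2, m' p.1.2 p.2)) :=
    ((hf.comp (by fun_prop)).mul (hh.comp (by fun_prop))).mul (hlog.comp hmm)
  set f₁ : A → ℝ := fun x ↦ ∫ x', f (x, x') ∂α' with hf₁
  set h₁ : B → ℝ := fun y ↦ ∫ y', h (y, y') ∂β' with hh₁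
  set g₁ : C → ℝ := fun z ↦ ∫ z', g (z, z') ∂γ' with hg₁
  set Ef : A → ℝ := fun x ↦ ∫ x', f (x, x') * Real.log (f (x, x')) ∂α' with hEf
  set Eh : B → ℝ := fun y ↦ ∫ y', h (y, y') * Real.log (h (y, y')) ∂β' with hEh
  have bf₁ : BddMeasurable f₁ := hf.integral α'
  have bh₁ : BddMeasurable h₁ := hh.integral β'
  have bg₁ : BddMeasurable g₁ := hg.integral γ'
  have bEf : BddMeasurable Ef := hf.mul_log.integral α'
  have bEh : BddMeasurable Eh := hh.mul_log.integral β'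
  have g₁pos : ∃ ε > 0, ∀ z, ε ≤ g₁ z := by
    refine ⟨ε * γ'.real univ, mul_pos hε ?_, fun z ↦ ?_⟩
    · exact ENNReal.toReal_pos (by simpa using hγ') (measure_ne_top _ _)
    · have := integral_mono (μ := γ') (integrable_const ε)
        ((hg.comp (measurable_prodMk_left (x := z))).integrable γ') fun z' ↦ hgε (z, z')
      simpa [mul_comm] using this
  have blog₁ : BddMeasurable fun p : A × B ↦ Real.log (g₁ (m p.1 p.2)) :=
    (bg₁.log g₁pos).comp hm
  have hlhs : ∫ p, ∫ q, f p * h q * Real.log (g (m p.1 q.1, m' p.2 q.2)) ∂(β.prod β') ∂(α.prod α')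
      = ∫ p : A × B, ∫ x', ∫ y', f (p.1, x') * h (p.2, y') *
        Real.log (g (m p.1 p.2, m' x' y')) ∂β' ∂α' ∂(α.prod β) := by
    have b1 : BddMeasurable fun p : (A × A') × (B × B') ↦
        f p.1 * h p.2 * Real.log (g (m p.1.1 p.2.1, m' p.1.2 p.2.2)) :=
      hF.comp (e := fun p : (A × A') × (B × B') ↦ (((p.1.1, p.2.1), p.1.2), p.2.2)) (by fun_prop)
    rw [integral_prod _ ((b1.integral (β.prod β')).integrable _),
      integral_prod _ (((hF.integral β').integral α').integrable _)]
    refine integral_congr_ae (ae_of_all _ fun x ↦ ?_)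
    simp only []
    have b2 : BddMeasurable fun p : (A' × B) × B' ↦
        f (x, p.1.1) * h (p.1.2, p.2) * Real.log (g (m x p.1.2, m' p.1.1 p.2)) :=
      hF.comp (e := fun p : (A' × B) × B' ↦ (((x, p.1.2), p.1.1), p.2)) (by fun_prop)
    refine Eq.trans (integral_congr_ae (ae_of_all _ fun x' ↦ ?_))
      (integral_integral_swap ((b2.integral β').integrable _))
    exact integral_prod _ ((b1.comp (measurable_prodMk_left (x := (x, x')))).integrable _)
  have i1 : Integrable (fun p : A × B ↦ u * (Ef p.1 * h₁ p.2)) (α.prod β) :=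
    ((bEf.comp measurable_fst).mul (bh₁.comp measurable_snd)).integrable _ |>.const_mul _
  have i2 : Integrable (fun p : A × B ↦ v * (f₁ p.1 * Eh p.2)) (α.prod β) :=
    ((bf₁.comp measurable_fst).mul (bEh.comp measurable_snd)).integrable _ |>.const_mul _
  have i3 : Integrable (fun p : A × B ↦ f₁ p.1 * h₁ p.2 * Real.log (g₁ (m p.1 p.2))) (α.prod β) :=
    (((bf₁.comp measurable_fst).mul (bh₁.comp measurable_snd)).mul blog₁).integrable _
  have i4 : Integrable (fun p : A × B ↦ u * (f₁ p.1 * Real.log (f₁ p.1) * h₁ p.2)) (α.prod β) :=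
    ((bf₁.mul_log.comp measurable_fst).mul (bh₁.comp measurable_snd)).integrable _ |>.const_mul _
  have i5 : Integrable (fun p : A × B ↦ v * (f₁ p.1 * (h₁ p.2 * Real.log (h₁ p.2)))) (α.prod β) :=
    ((bf₁.comp measurable_fst).mul (bh₁.mul_log.comp measurable_snd)).integrable _ |>.const_mul _
  have i12 : Integrable (fun p : A × B ↦ u * (Ef p.1 * h₁ p.2) + v * (f₁ p.1 * Eh p.2))
      (α.prod β) := i1.add i2
  have i13 : Integrable (fun p : A × B ↦ u * (Ef p.1 * h₁ p.2) + v * (f₁ p.1 * Eh p.2)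
      + f₁ p.1 * h₁ p.2 * Real.log (g₁ (m p.1 p.2))) (α.prod β) := i12.add i3
  have i14 : Integrable (fun p : A × B ↦ u * (Ef p.1 * h₁ p.2) + v * (f₁ p.1 * Eh p.2)
      + f₁ p.1 * h₁ p.2 * Real.log (g₁ (m p.1 p.2))
      - u * (f₁ p.1 * Real.log (f₁ p.1) * h₁ p.2)) (α.prod β) := i13.sub i4
  have step : ∫ p : A × B, ∫ x', ∫ y', f (p.1, x') * h (p.2, y') *
        Real.log (g (m p.1 p.2, m' x' y')) ∂β' ∂α' ∂(α.prod β)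
      ≤ ∫ p : A × B, (u * (Ef p.1 * h₁ p.2) + v * (f₁ p.1 * Eh p.2)
      + f₁ p.1 * h₁ p.2 * Real.log (g₁ (m p.1 p.2))
      - u * (f₁ p.1 * Real.log (f₁ p.1) * h₁ p.2)
      - v * (f₁ p.1 * (h₁ p.2 * Real.log (h₁ p.2)))) ∂(α.prod β) := by
    refine integral_mono (((hF.integral β').integral α').integrable _) (i14.sub i5) fun p ↦ ?_
    have := H' (fun x' ↦ f (p.1, x')) (fun y' ↦ h (p.2, y')) (fun z' ↦ g (m p.1 p.2, z'))
      (hf.comp measurable_prodMk_left) (hh.comp measurable_prodMk_left)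
      (hg.comp measurable_prodMk_left) (fun _ ↦ hf0 _) (fun _ ↦ hh0 _) ⟨ε, hε, fun _ ↦ hgε _⟩
    refine this.trans (le_of_eq ?_)
    simp only [hEf, hEh, hf₁, hh₁, hg₁]
    ring
  rw [integral_sub i14 i5, integral_sub i13 i4, integral_add i12 i3, integral_add i1 i2,
    integral_const_mul, integral_const_mul, integral_const_mul, integral_const_mul,
    integral_prod_mul, integral_prod_mul, integral_prod_mul (fun x ↦ f₁ x * Real.log (f₁ x)),
    integral_prod_mul f₁ (fun x ↦ h₁ x * Real.log (h₁ x)), integral_prod _ i3] at step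
  have fin := H f₁ h₁ g₁ bf₁ bh₁ bg₁ (fun x ↦ integral_nonneg fun _ ↦ hf0 _)
    (fun x ↦ integral_nonneg fun _ ↦ hh0 _) g₁pos
  rw [hlhs, integral_prod _ (hf.integrable _), integral_prod _ (hh.integrable _),
    integral_prod _ (hg.integrable _), integral_prod _ (hf.mul_log.integrable _),
    integral_prod _ (hh.mul_log.integrable _)]
  simp only [← hEf, ← hEh, ← hf₁, ← hh₁, ← hg₁]
  linarith

theorem pi_fin {α₀ β₀ γ₀ : Measure ℝ} [IsFiniteMeasure α₀] [IsFiniteMeasure β₀]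
    [IsFiniteMeasure γ₀] (hγ₀ : γ₀ ≠ 0) {c s : ℝ}
    (H : EntropyIneq u v α₀ β₀ γ₀ fun x y ↦ c * x + s * y) (n : ℕ) :
    EntropyIneq u v (Measure.pi fun _ : Fin n ↦ α₀) (Measure.pi fun _ : Fin n ↦ β₀)
      (Measure.pi fun _ : Fin n ↦ γ₀) fun x y ↦ c • x + s • y := by
  induction n with
  | zero =>
    intro f h g _ _ _ _ _ _
    simp only [Measure.pi_of_empty _ (0 : Fin 0 → ℝ), integral_dirac]
    rw [Subsingleton.elim (c • (0 : Fin 0 → ℝ) + s • (0 : Fin 0 → ℝ)) 0]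
    apply le_of_eq
    ring
  | succ n ih =>
    have hne : (Measure.pi fun _ : Fin n ↦ γ₀) ≠ 0 := by
      rw [Ne, ← Measure.measure_univ_eq_zero, Measure.pi_univ]
      simpa [Finset.prod_eq_zero_iff] using fun h ↦ absurd h hγ₀
    have h1 : Measurable (Function.uncurry fun x y : ℝ ↦ c * x + s * y) := by
      unfold Function.uncurry; fun_prop
    have h2 : Measurable (Function.uncurry fun x y : Fin n → ℝ ↦ c • x + s • y) := by
      unfold Function.uncurry; fun_prop
    refine (EntropyIneq.prod hne h1 h2 H ih).of_measurableEquiv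
      (MeasurableEquiv.piFinSuccAbove (fun _ ↦ ℝ) 0) (MeasurableEquiv.piFinSuccAbove (fun _ ↦ ℝ) 0)
      (MeasurableEquiv.piFinSuccAbove (fun _ ↦ ℝ) 0)
      (measurePreserving_piFinSuccAbove (fun _ ↦ α₀) 0)
      (measurePreserving_piFinSuccAbove (fun _ ↦ β₀) 0)
      (measurePreserving_piFinSuccAbove (fun _ ↦ γ₀) 0) fun x y ↦ ?_
    rfl

end EntropyIneq

theorem BddMeasurable.exists_continuous_approx {f : ℝ → ℝ} (hf : BddMeasurable f)
    (h0 : ∀ x, 0 ≤ f x) :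
    ∃ (C : ℝ) (F : ℕ → ℝ → ℝ), (∀ n, Continuous (F n)) ∧ (∀ n, ∃ δ > 0, ∀ x, δ ≤ F n x) ∧
      (∀ n x, F n x ≤ C) ∧ ∀ᵐ x, Tendsto (fun n ↦ F n x) atTop (𝓝 (f x)) := by
  obtain ⟨hm, C, hC⟩ := hf
  have hloc : LocallyIntegrable f := (locallyIntegrable_const C).mono hm.aestronglyMeasurable
    (ae_of_all _ fun x ↦ by
      rw [Real.norm_eq_abs, Real.norm_eq_abs]; exact (hC x).trans (le_abs_self C))
  have hintg : ∀ a b, IntervalIntegrable f volume a b := fun a b ↦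
    (hloc.integrableOn_isCompact isCompact_uIcc).intervalIntegrable
  refine ⟨C + 1, fun n x ↦ (n + 1 : ℝ) * (∫ t in x..(x + 1 / (n + 1)), f t) + 1 / (n + 1),
    fun n ↦ ?_, fun n ↦ ⟨1 / (n + 1), by positivity, fun x ↦ ?_⟩, fun n x ↦ ?_, ?_⟩
  · have hc : Continuous fun x ↦ ∫ t in (0 : ℝ)..x, f t :=
      intervalIntegral.continuous_primitive hintg 0
    have : (fun x ↦ ∫ t in x..(x + 1 / (n + 1 : ℝ)), f t) = fun x ↦
        (∫ t in (0 : ℝ)..(x + 1 / (n + 1)), f t) - ∫ t in (0 : ℝ)..x, f t := by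
      funext x
      rw [intervalIntegral.integral_interval_sub_left (hintg _ _) (hintg _ _)]
    have hc' : Continuous fun x ↦ ∫ t in x..(x + 1 / (n + 1 : ℝ)), f t := by
      rw [this]
      exact (hc.comp (by fun_prop)).sub hc
    exact (hc'.const_mul _).add continuous_const
  · have hle : x ≤ x + 1 / (n + 1 : ℝ) := by
      have : (0 : ℝ) < 1 / (n + 1) := by positivity
      linarith
    have := intervalIntegral.integral_nonneg (μ := volume) hle fun t _ ↦ h0 t
    have : 0 ≤ (n + 1 : ℝ) * ∫ t in x..(x + 1 / (n + 1)), f t := by positivity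
    linarith
  · have hle : x ≤ x + 1 / (n + 1 : ℝ) := by
      have : (0 : ℝ) < 1 / (n + 1) := by positivity
      linarith
    have h1 := intervalIntegral.integral_mono_on (μ := volume) hle (hintg _ _)
      intervalIntegrable_const fun t _ ↦ (le_abs_self _).trans (hC t)
    rw [intervalIntegral.integral_const, add_sub_cancel_left, smul_eq_mul] at h1
    have hn : (0 : ℝ) < n + 1 := by positivity
    have h2 := mul_le_mul_of_nonneg_left h1 hn.le
    have h3 : (n + 1 : ℝ) * (1 / (n + 1) * C) = C := by field_simp
    have h4 : 1 / (n + 1 : ℝ) ≤ 1 := by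
      rw [div_le_one hn]; have : (0 : ℝ) ≤ n := by positivity
      linarith
    linarith
  · filter_upwards [_root_.LocallyIntegrable.ae_hasDerivAt_integral hloc] with x hx
    have h1 := (hx 0).tendsto_slope
    have hto : Tendsto (fun n : ℕ ↦ x + 1 / (n + 1 : ℝ)) atTop (𝓝[≠] x) := by
      refine tendsto_nhdsWithin_iff.2 ⟨?_, .of_forall fun n ↦ ?_⟩
      · simpa using tendsto_one_div_add_atTop_nhds_zero_nat.const_add x
      · have : (0 : ℝ) < 1 / (n + 1) := by positivity
        simp only [mem_compl_iff, mem_singleton_iff]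
        linarith
    have h2 := (h1.comp hto).add (tendsto_one_div_add_atTop_nhds_zero_nat (𝕜 := ℝ))
    rw [add_zero] at h2
    refine h2.congr fun n ↦ ?_
    rw [Function.comp_apply, slope_def_field, add_sub_cancel_left,
      intervalIntegral.integral_interval_sub_left (hintg _ _) (hintg _ _), div_div_eq_mul_div,
      div_one, mul_comm]

theorem entropyIneq_interval {c s R : ℝ} (hc : 0 ≤ c) (hs : 0 ≤ s) (hcs : c ^ 2 + s ^ 2 = 1)
    (hR : 0 < R) :
    EntropyIneq (c ^ 2) (s ^ 2) (volume.restrict (Icc (-R) R)) (volume.restrict (Icc (-R) R))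
      (volume.restrict (Icc (-(2 * R)) (2 * R))) fun x y ↦ c * x + s * y := by
  intro f h g hf hh hg hf0 hh0 ⟨ε, hε, hgε⟩
  obtain ⟨C, F, hFc, hFδ, hFC, hF⟩ := hf.exists_continuous_approx hf0
  obtain ⟨D, K, hKc, hKδ, hKD, hK⟩ := hh.exists_continuous_approx hh0
  obtain ⟨M, hM⟩ := hg.2
  set μ : Measure ℝ := volume.restrict (Icc (-R) R) with hμ
  have hF0 : ∀ n x, 0 ≤ F n x := fun n x ↦ by
    obtain ⟨δ, h, h'⟩ := hFδ n
    exact h.le.trans (h' x)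
  have hK0 : ∀ n x, 0 ≤ K n x := fun n x ↦ by
    obtain ⟨δ, h, h'⟩ := hKδ n
    exact h.le.trans (h' x)
  have hF' : ∀ᵐ x ∂μ, Tendsto (fun n ↦ F n x) atTop (𝓝 (f x)) := ae_restrict_of_ae hF
  have hK' : ∀ᵐ x ∂μ, Tendsto (fun n ↦ K n x) atTop (𝓝 (h x)) := ae_restrict_of_ae hK
  have hFb : ∀ n, BddMeasurable (F n) := fun n ↦ ⟨(hFc n).measurable, C, fun x ↦ by
    rw [abs_of_nonneg (hF0 n x)]; exact hFC n x⟩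
  have hKb : ∀ n, BddMeasurable (K n) := fun n ↦ ⟨(hKc n).measurable, D, fun x ↦ by
    rw [abs_of_nonneg (hK0 n x)]; exact hKD n x⟩
  have lim : ∀ (k : ℝ → ℝ) (G : ℕ → ℝ → ℝ) (E : ℝ), (∀ n, BddMeasurable (G n)) →
      (∀ n x, 0 ≤ G n x) → (∀ n x, G n x ≤ E) →
      (∀ᵐ x ∂μ, Tendsto (fun n ↦ G n x) atTop (𝓝 (k x))) →
      Tendsto (fun n ↦ ∫ x, G n x ∂μ) atTop (𝓝 (∫ x, k x ∂μ)) ∧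
      Tendsto (fun n ↦ ∫ x, G n x * Real.log (G n x) ∂μ) atTop
        (𝓝 (∫ x, k x * Real.log (k x) ∂μ)) := by
    intro k G E hGb hG0 hGE hG
    refine ⟨?_, ?_⟩
    · refine tendsto_integral_of_dominated_convergence (fun _ ↦ E)
        (fun n ↦ (hGb n).1.aestronglyMeasurable) (integrable_const _)
        (fun n ↦ ae_of_all _ fun x ↦ ?_) hG
      rw [Real.norm_of_nonneg (hG0 n x)]
      exact hGE n x
    · obtain ⟨B, hB⟩ := (isCompact_Icc (a := 0) (b := E)).exists_bound_of_continuousOn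
        Real.continuous_mul_log.continuousOn
      refine tendsto_integral_of_dominated_convergence (fun _ ↦ B)
        (fun n ↦ (hGb n).mul_log.1.aestronglyMeasurable) (integrable_const _)
        (fun n ↦ ae_of_all _ fun x ↦ hB _ ⟨hG0 n x, hGE n x⟩) ?_
      filter_upwards [hG] with x hx
      exact (Real.continuous_mul_log.tendsto _).comp hx
  obtain ⟨lf, lf'⟩ := lim f F C hFb hF0 hFC hF'
  obtain ⟨lh, lh'⟩ := lim h K D hKb hK0 hKD hK'
  have hl : BddMeasurable fun p : ℝ × ℝ ↦ Real.log (g (c * p.1 + s * p.2)) :=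
    (hg.log ⟨ε, hε, hgε⟩).comp (by fun_prop)
  have hprod : ∀ (k₁ k₂ : ℝ → ℝ), BddMeasurable k₁ → BddMeasurable k₂ →
      BddMeasurable fun p : ℝ × ℝ ↦ k₁ p.1 * k₂ p.2 * Real.log (g (c * p.1 + s * p.2)) :=
    fun k₁ k₂ h₁ h₂ ↦ ((h₁.comp measurable_fst).mul (h₂.comp measurable_snd)).mul hl
  have ll : Tendsto (fun n ↦ ∫ x, ∫ y, F n x * K n y * Real.log (g (c * x + s * y)) ∂μ ∂μ) atTop
      (𝓝 (∫ x, ∫ y, f x * h y * Real.log (g (c * x + s * y)) ∂μ ∂μ)) := by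
    have e : ∀ (k₁ k₂ : ℝ → ℝ), BddMeasurable k₁ → BddMeasurable k₂ →
        ∫ x, ∫ y, k₁ x * k₂ y * Real.log (g (c * x + s * y)) ∂μ ∂μ
        = ∫ p, k₁ p.1 * k₂ p.2 * Real.log (g (c * p.1 + s * p.2)) ∂(μ.prod μ) :=
      fun k₁ k₂ h₁ h₂ ↦ (integral_prod _ ((hprod k₁ k₂ h₁ h₂).integrable _)).symm
    rw [e f h hf hh]
    simp_rw [fun n ↦ e (F n) (K n) (hFb n) (hKb n)]
    obtain ⟨L, hL⟩ := hl.2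
    refine tendsto_integral_of_dominated_convergence (fun _ ↦ C * D * L)
      (fun n ↦ (hprod _ _ (hFb n) (hKb n)).1.aestronglyMeasurable) (integrable_const _)
      (fun n ↦ ae_of_all _ fun p ↦ ?_) ?_
    · rw [Real.norm_eq_abs, abs_mul, abs_mul, abs_of_nonneg (hF0 n _), abs_of_nonneg (hK0 n _)]
      have hC0 : 0 ≤ C := (hF0 n p.1).trans (hFC n p.1)
      exact mul_le_mul (mul_le_mul (hFC n _) (hKD n _) (hK0 n _) hC0) (hL p) (abs_nonneg _)
        (mul_nonneg hC0 ((hK0 n p.1).trans (hKD n p.1)))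
    · filter_upwards [Measure.quasiMeasurePreserving_fst.ae hF',
        Measure.quasiMeasurePreserving_snd.ae hK'] with p h1 h2
      exact (h1.mul h2).mul_const _
  have cl := Real.continuous_mul_log.tendsto
  refine le_of_tendsto_of_tendsto' ll (((((lh.const_mul (c ^ 2)).mul lf').add
    ((lf.const_mul (s ^ 2)).mul lh')).add ((lf.mul lh).mul_const _)).sub
    ((lh.const_mul (c ^ 2)).mul ((cl _).comp lf)) |>.sub
    ((lf.const_mul (s ^ 2)).mul ((cl _).comp lh))) fun n ↦ ?_
  obtain ⟨δ, hδ, hFδ⟩ := hFδ n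
  obtain ⟨δ', hδ', hKδ⟩ := hKδ n
  exact entropy_ineq_interval_of_continuous hc hs hcs (δ := min δ δ') (C := max C D)
    (lt_min hδ hδ') hε hR (hFc n) (hKc n) hg.1 (fun x ↦ (min_le_left _ _).trans (hFδ x))
    (fun x ↦ (hFC n x).trans (le_max_left _ _)) (fun x ↦ (min_le_right _ _).trans (hKδ x))
    (fun x ↦ (hKD n x).trans (le_max_right _ _)) hgε fun z ↦ (le_abs_self _).trans (hM z)

theorem entropyIneq_cube {c s R : ℝ} (hc : 0 ≤ c) (hs : 0 ≤ s) (hcs : c ^ 2 + s ^ 2 = 1)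
    (hR : 0 < R) (n : ℕ) :
    EntropyIneq (c ^ 2) (s ^ 2)
      (volume.restrict (Set.pi univ fun _ : Fin n ↦ Icc (-R) R))
      (volume.restrict (Set.pi univ fun _ : Fin n ↦ Icc (-R) R))
      (volume.restrict (Set.pi univ fun _ : Fin n ↦ Icc (-(2 * R)) (2 * R)))
      fun x y ↦ c • x + s • y := by
  have hne : (volume.restrict (Icc (-(2 * R)) (2 * R)) : Measure ℝ) ≠ 0 := by
    rw [Ne, Measure.restrict_eq_zero, Real.volume_Icc, ENNReal.ofReal_eq_zero]
    linarith
  have := (entropyIneq_interval hc hs hcs hR).pi_fin hne n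
  simp only [← Measure.restrict_pi_pi] at this
  exact this

theorem abs_min_mul_log_min_le {x N : ℝ} (hx : 0 ≤ x) (hN : 1 ≤ N) :
    |min x N * Real.log (min x N)| ≤ |x * Real.log x| := by
  rcases le_total x N with h | h
  · rw [min_eq_left h]
  · rw [min_eq_right h, abs_of_nonneg (mul_nonneg (by linarith) (Real.log_nonneg hN)),
      abs_of_nonneg (mul_nonneg hx (Real.log_nonneg (hN.trans h)))]
    exact mul_le_mul h (Real.log_le_log (by linarith) h) (Real.log_nonneg hN) hx

theorem abs_log_min_add_le {x N ε : ℝ} (hx : 0 < x) (hN : 1 ≤ N) (hε : 0 < ε) (hε1 : ε ≤ 1) :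
    |Real.log (min x N + ε)| ≤ |Real.log x| + Real.log 2 := by
  have h2 : 0 < Real.log 2 := Real.log_pos (by norm_num)
  have hm : 0 < min x N := lt_min hx (by linarith)
  have ha := neg_abs_le (Real.log x)
  refine abs_le.2 ⟨?_, ?_⟩
  · rcases le_total x N with h | h
    · rw [min_eq_left h]
      have := Real.log_le_log hx (show x ≤ x + ε by linarith)
      linarith
    · rw [min_eq_right h]
      have := Real.log_nonneg (show 1 ≤ N + ε by linarith)
      linarith [abs_nonneg (Real.log x)]
  · have h1 : min x N + ε ≤ x + 1 := add_le_add (min_le_left _ _) hε1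
    have h3 := Real.log_le_log (by linarith) h1
    rcases le_total 1 x with h | h
    · have h4 := Real.log_le_log (by linarith) (show x + 1 ≤ 2 * x by linarith)
      rw [Real.log_mul (by norm_num) hx.ne'] at h4
      linarith [le_abs_self (Real.log x)]
    · have h4 := Real.log_le_log (by linarith) (show x + 1 ≤ 2 by linarith)
      linarith [abs_nonneg (Real.log x)]

/-- The cube of half-side `k + 1` centred at the origin. -/
def cubeNat (n k : ℕ) : Set (Fin n → ℝ) :=
  Set.pi univ fun _ ↦ Icc (-(k + 1 : ℝ)) (k + 1)

theorem measurableSet_cubeNat (n k : ℕ) : MeasurableSet (cubeNat n k) :=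
  MeasurableSet.univ_pi fun _ ↦ measurableSet_Icc

theorem eventually_mem_cubeNat {n : ℕ} (x : Fin n → ℝ) : ∀ᶠ k in atTop, x ∈ cubeNat n k := by
  simp only [cubeNat, Set.mem_pi, mem_univ, forall_true_left]
  refine eventually_all.2 fun i ↦ ?_
  filter_upwards [tendsto_natCast_atTop_atTop.eventually_ge_atTop |x i|] with k hk
  have := abs_le.1 hk
  exact ⟨by linarith [this.1], by linarith [this.2]⟩

theorem eventually_min_natCast_add_one_eq (x : ℝ) :
    ∀ᶠ k : ℕ in atTop, min x (k + 1 : ℝ) = x := by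
  filter_upwards [tendsto_natCast_atTop_atTop.eventually_ge_atTop x] with k hk
  exact min_eq_left (by linarith)

theorem tendsto_setIntegral_cubeNat_truncation {n : ℕ} {f : (Fin n → ℝ) → ℝ} (hf0 : ∀ x, 0 ≤ f x)
    (hf : Measurable f) {φ : ℝ → ℝ} (hφ : Measurable φ) (hintg : Integrable fun x ↦ φ (f x))
    (hle : ∀ x N, 0 ≤ x → 1 ≤ N → |φ (min x N)| ≤ |φ x|) :
    Tendsto (fun k : ℕ ↦ ∫ x in cubeNat n k, φ (min (f x) (k + 1))) atTop
      (𝓝 (∫ x, φ (f x))) := by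
  refine Tendsto.congr (fun k ↦ integral_indicator (measurableSet_cubeNat n k)) ?_
  refine tendsto_integral_of_dominated_convergence (fun x ↦ |φ (f x)|)
    (fun k ↦ ((hφ.comp (hf.min measurable_const)).indicator
      (measurableSet_cubeNat n k)).aestronglyMeasurable) hintg.abs
    (fun k ↦ ae_of_all _ fun x ↦ ?_) (ae_of_all _ fun x ↦ ?_)
  · refine (norm_indicator_le_norm_self _ _).trans ?_
    exact hle _ _ (hf0 x) (by linarith [(Nat.cast_nonneg k : (0 : ℝ) ≤ k)])
  · refine tendsto_const_nhds.congr' ?_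
    filter_upwards [eventually_mem_cubeNat x, eventually_min_natCast_add_one_eq (f x)] with k h1 h2
    rw [indicator_of_mem h1, h2]

theorem BddMeasurable.min_const {A : Type*} [MeasurableSpace A] {f : A → ℝ} (hf : Measurable f)
    (h0 : ∀ x, 0 ≤ f x) {N : ℝ} (hN : 0 ≤ N) : BddMeasurable fun x ↦ min (f x) N :=
  ⟨hf.min measurable_const, N, fun x ↦ by
    rw [abs_of_nonneg (le_min (h0 x) hN)]; exact min_le_right _ _⟩

theorem integral_prod_mul_log_le {n : ℕ} {c s : ℝ} (hc : 0 ≤ c) (hs : 0 ≤ s)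
    (hcs : c ^ 2 + s ^ 2 = 1) {f h g : (Fin n → ℝ) → ℝ}
    (hf : Measurable f) (hh : Measurable h) (hg : Measurable g)
    (hf0 : ∀ x, 0 ≤ f x) (hh0 : ∀ x, 0 ≤ h x) (hg0 : ∀ x, 0 ≤ g x)
    (hfi : Integrable f) (hhi : Integrable h) (hgi : Integrable g)
    (hf1 : ∫ x, f x = 1) (hh1 : ∫ x, h x = 1) (hg1 : ∫ x, g x = 1)
    (hfl : Integrable fun x ↦ f x * Real.log (f x))
    (hhl : Integrable fun x ↦ h x * Real.log (h x))
    (hL : Integrable (fun p : (Fin n → ℝ) × (Fin n → ℝ) ↦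
      f p.1 * h p.2 * Real.log (g (c • p.1 + s • p.2))) (volume.prod volume))
    (hpos : ∀ᵐ p : (Fin n → ℝ) × (Fin n → ℝ) ∂(volume.prod volume), f p.1 * h p.2 ≠ 0 →
      0 < g (c • p.1 + s • p.2)) :
    ∫ p : (Fin n → ℝ) × (Fin n → ℝ), f p.1 * h p.2 * Real.log (g (c • p.1 + s • p.2))
        ∂(volume.prod volume)
      ≤ c ^ 2 * (∫ x, f x * Real.log (f x)) + s ^ 2 * ∫ x, h x * Real.log (h x) := by
  have hk0 : ∀ k : ℕ, (0 : ℝ) < k + 1 := fun k ↦ by positivity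
  have hk1 : ∀ k : ℕ, (1 : ℝ) ≤ k + 1 := fun k ↦ by linarith [(Nat.cast_nonneg k : (0 : ℝ) ≤ k)]
  set Q' : ℕ → Set (Fin n → ℝ) := fun k ↦
    Set.pi univ fun _ ↦ Icc (-(2 * (k + 1 : ℝ))) (2 * (k + 1)) with hQ'
  set V : ℕ → ℝ := fun k ↦ (volume.restrict (Q' k)).real univ with hV
  have hQ'fin : ∀ k, IsFiniteMeasure (volume.restrict (Q' k)) := fun k ↦
    ⟨by rw [Measure.restrict_apply_univ]
        exact (isCompact_univ_pi fun _ ↦ isCompact_Icc).measure_lt_top⟩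
  have hQfin : ∀ k, IsFiniteMeasure (volume.restrict (cubeNat n k)) := fun k ↦
    ⟨by rw [Measure.restrict_apply_univ]
        exact (isCompact_univ_pi fun _ ↦ isCompact_Icc).measure_lt_top⟩
  have hV0 : ∀ k, 0 ≤ V k := fun k ↦ measureReal_nonneg
  set ε : ℕ → ℝ := fun k ↦ 1 / ((k + 1) * (V k + 1)) with hε
  have hε0 : ∀ k, 0 < ε k := fun k ↦ by have := hV0 k; positivity
  have hεV : ∀ k, ε k * V k ≤ 1 / (k + 1) := fun k ↦ by
    have := hV0 k
    have h3 : ε k * (V k + 1) = 1 / (k + 1) := by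
      simp only [hε]; field_simp
    have := hε0 k
    linarith
  have hεk : ∀ k, ε k ≤ 1 / (k + 1) := fun k ↦ by
    have := hV0 k
    refine one_div_le_one_div_of_le (hk0 k) ?_
    exact le_mul_of_one_le_right (hk0 k).le (by linarith)
  have hε1 : ∀ k, ε k ≤ 1 := fun k ↦ (hεk k).trans ((div_le_one (hk0 k)).2 (hk1 k))
  have hεlim : Tendsto ε atTop (𝓝 0) := squeeze_zero (fun k ↦ (hε0 k).le) hεk
    tendsto_one_div_add_atTop_nhds_zero_nat
  have bf : ∀ k : ℕ, BddMeasurable fun x ↦ min (f x) (k + 1) := fun k ↦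
    BddMeasurable.min_const hf hf0 (hk0 k).le
  have bh : ∀ k : ℕ, BddMeasurable fun x ↦ min (h x) (k + 1) := fun k ↦
    BddMeasurable.min_const hh hh0 (hk0 k).le
  have bg : ∀ k : ℕ, BddMeasurable fun x ↦ min (g x) (k + 1) + ε k := fun k ↦
    ⟨(hg.min measurable_const).add_const _, k + 1 + ε k, fun x ↦ by
      rw [abs_of_nonneg (add_nonneg (le_min (hg0 x) (hk0 k).le) (hε0 k).le)]
      exact add_le_add_left (min_le_right _ _) _⟩
  have min0 : ∀ {q : (Fin n → ℝ) → ℝ}, (∀ x, 0 ≤ q x) → ∀ (k : ℕ) x, 0 ≤ min (q x) (k + 1 : ℝ) :=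
    fun hq k x ↦ le_min (hq x) (hk0 k).le
  have idle : ∀ x N : ℝ, 0 ≤ x → 1 ≤ N → |min x N| ≤ |x| := fun x N hx hN ↦ by
    rw [abs_of_nonneg (le_min hx (by linarith)), abs_of_nonneg hx]; exact min_le_left _ _
  have hφ : Measurable fun x : ℝ ↦ x * Real.log x := Real.continuous_mul_log.measurable
  have la := tendsto_setIntegral_cubeNat_truncation hf0 hf measurable_id hfi idle
  have lb := tendsto_setIntegral_cubeNat_truncation hh0 hh measurable_id hhi idle
  have lA := tendsto_setIntegral_cubeNat_truncation hf0 hf hφ hfl fun _ _ ↦ abs_min_mul_log_min_le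
  have lB := tendsto_setIntegral_cubeNat_truncation hh0 hh hφ hhl fun _ _ ↦ abs_min_mul_log_min_le
  simp only [id_eq, hf1, hh1] at la lb
  have hm : Measurable fun p : (Fin n → ℝ) × (Fin n → ℝ) ↦ c • p.1 + s • p.2 := by fun_prop
  have bF : ∀ k : ℕ, BddMeasurable fun p : (Fin n → ℝ) × (Fin n → ℝ) ↦
      min (f p.1) (k + 1) * min (h p.2) (k + 1) *
        Real.log (min (g (c • p.1 + s • p.2)) (k + 1) + ε k) := fun k ↦
    (((bf k).comp measurable_fst).mul ((bh k).comp measurable_snd)).mul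
      (((bg k).log ⟨ε k, hε0 k, fun z ↦ le_add_of_nonneg_left (min0 hg0 k z)⟩).comp hm)
  have lL : Tendsto (fun k : ℕ ↦ ∫ x in cubeNat n k, ∫ y in cubeNat n k,
      min (f x) (k + 1) * min (h y) (k + 1) * Real.log (min (g (c • x + s • y)) (k + 1) + ε k))
      atTop (𝓝 (∫ p : (Fin n → ℝ) × (Fin n → ℝ),
        f p.1 * h p.2 * Real.log (g (c • p.1 + s • p.2)) ∂(volume.prod volume))) := by
    have hQQ := fun k ↦ (measurableSet_cubeNat n k).prod (measurableSet_cubeNat n k)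
    have e : ∀ k : ℕ, ∫ x in cubeNat n k, ∫ y in cubeNat n k,
        min (f x) (k + 1) * min (h y) (k + 1) * Real.log (min (g (c • x + s • y)) (k + 1) + ε k)
        = ∫ p, (cubeNat n k ×ˢ cubeNat n k).indicator (fun p : (Fin n → ℝ) × (Fin n → ℝ) ↦
          min (f p.1) (k + 1) * min (h p.2) (k + 1) *
          Real.log (min (g (c • p.1 + s • p.2)) (k + 1) + ε k)) p ∂(volume.prod volume) := by
      intro k
      rw [integral_indicator (hQQ k), ← Measure.prod_restrict,
        integral_prod _ ((bF k).integrable _)]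
    simp_rw [e]
    have hfh : Integrable (fun p : (Fin n → ℝ) × (Fin n → ℝ) ↦ f p.1 * h p.2)
      (volume.prod volume) := hfi.mul_prod hhi
    refine tendsto_integral_of_dominated_convergence (fun p ↦
      |f p.1 * h p.2 * Real.log (g (c • p.1 + s • p.2))| + f p.1 * h p.2 * Real.log 2)
      (fun k ↦ ((bF k).1.indicator (hQQ k)).aestronglyMeasurable)
      (hL.abs.add (hfh.mul_const _)) (fun k ↦ ?_) ?_
    · filter_upwards [hpos] with p hp
      refine (norm_indicator_le_norm_self _ _).trans ?_
      have hfp := hf0 p.1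
      have hhp := hh0 p.2
      rw [Real.norm_eq_abs, abs_mul, abs_mul (f p.1 * h p.2), abs_of_nonneg (mul_nonneg hfp hhp),
        abs_of_nonneg (mul_nonneg (min0 hf0 k _) (min0 hh0 k _)), ← mul_add]
      by_cases h0 : f p.1 * h p.2 = 0
      · have : min (f p.1) (k + 1 : ℝ) * min (h p.2) (k + 1 : ℝ) = 0 := by
          rcases mul_eq_zero.1 h0 with h | h
          · rw [h, min_eq_left (hk0 k).le, zero_mul]
          · rw [h, min_eq_left (hk0 k).le, mul_zero]
        rw [this, h0, zero_mul, zero_mul]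
      · exact mul_le_mul (mul_le_mul (min_le_left _ _) (min_le_left _ _) (min0 hh0 k _) hfp)
          (abs_log_min_add_le (hp h0) (hk1 k) (hε0 k) (hε1 k)) (abs_nonneg _) (mul_nonneg hfp hhp)
    · filter_upwards [hpos] with p hp
      have ev : ∀ᶠ k : ℕ in atTop, f p.1 * h p.2 * Real.log (g (c • p.1 + s • p.2) + ε k)
          = (cubeNat n k ×ˢ cubeNat n k).indicator (fun p : (Fin n → ℝ) × (Fin n → ℝ) ↦
          min (f p.1) (k + 1) * min (h p.2) (k + 1) *
          Real.log (min (g (c • p.1 + s • p.2)) (k + 1) + ε k)) p := by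
        filter_upwards [eventually_mem_cubeNat p.1, eventually_mem_cubeNat p.2,
          eventually_min_natCast_add_one_eq (f p.1), eventually_min_natCast_add_one_eq (h p.2),
          eventually_min_natCast_add_one_eq (g (c • p.1 + s • p.2))] with k h1 h2 h3 h4 h5
        rw [indicator_of_mem (mk_mem_prod h1 h2), h3, h4, h5]
      refine Tendsto.congr' ev ?_
      by_cases h0 : f p.1 * h p.2 = 0
      · simp [h0]
      · refine Tendsto.const_mul _ ?_
        have := (hεlim.const_add (g (c • p.1 + s • p.2)))
        rw [add_zero] at this
        exact this.log (hp h0).ne'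
  have ll : Tendsto (fun k : ℕ ↦ Real.log (1 + 1 / (k + 1 : ℝ))) atTop (𝓝 0) := by
    have := (tendsto_one_div_add_atTop_nhds_zero_nat (𝕜 := ℝ)).const_add 1
    rw [add_zero] at this
    simpa using this.log one_ne_zero
  have cl := (Real.continuous_mul_log.tendsto 1)
  have fin := le_of_tendsto_of_tendsto' lL (((((lb.const_mul (c ^ 2)).mul lA).add
    ((la.const_mul (s ^ 2)).mul lB)).add ((la.mul lb).mul ll)).sub
    ((lb.const_mul (c ^ 2)).mul (cl.comp la)) |>.sub
    ((la.const_mul (s ^ 2)).mul (cl.comp lb))) fun k ↦ ?_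
  · simpa using fin
  have key := entropyIneq_cube hc hs hcs (hk0 k) n (fun x ↦ min (f x) (k + 1))
    (fun x ↦ min (h x) (k + 1)) (fun x ↦ min (g x) (k + 1) + ε k) (bf k) (bh k) (bg k)
    (min0 hf0 k) (min0 hh0 k)
    ⟨ε k, hε0 k, fun z ↦ le_add_of_nonneg_left (min0 hg0 k z)⟩
  have hgk : ∫ x in Q' k, (min (g x) (k + 1) + ε k) ≤ 1 + 1 / (k + 1 : ℝ) := by
    have i1 : Integrable (fun x ↦ min (g x) (k + 1 : ℝ)) (volume.restrict (Q' k)) :=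
      (BddMeasurable.min_const hg hg0 (hk0 k).le).integrable _
    rw [integral_add i1 (integrable_const _), integral_const, smul_eq_mul, mul_comm]
    refine add_le_add ?_ (hεV k)
    calc ∫ x in Q' k, min (g x) (k + 1 : ℝ) ≤ ∫ x in Q' k, g x :=
          integral_mono i1 hgi.integrableOn fun x ↦ min_le_left _ _
      _ ≤ ∫ x, g x := setIntegral_le_integral hgi (ae_of_all _ hg0)
      _ = 1 := hg1
  have hgk0 : 0 ≤ ∫ x in Q' k, (min (g x) (k + 1) + ε k) :=
    integral_nonneg fun x ↦ add_nonneg (min0 hg0 k x) (hε0 k).le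
  have hlog : Real.log (∫ x in Q' k, (min (g x) (k + 1) + ε k))
      ≤ Real.log (1 + 1 / (k + 1 : ℝ)) := by
    rcases hgk0.eq_or_lt with h | h
    · rw [← h, Real.log_zero]
      exact Real.log_nonneg (by have := hk0 k; simp; positivity)
    · exact Real.log_le_log h hgk
  have hab : 0 ≤ (∫ x in cubeNat n k, min (f x) (k + 1 : ℝ)) *
      ∫ x in cubeNat n k, min (h x) (k + 1 : ℝ) :=
    mul_nonneg (integral_nonneg (min0 hf0 k)) (integral_nonneg (min0 hh0 k))
  have := mul_le_mul_of_nonneg_left hlog hab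
  refine key.trans ?_
  simp only [Function.comp_apply]
  exact sub_le_sub_right (sub_le_sub_right (add_le_add_right this _) _) _

theorem map_prod_eq_withDensity_pdf {Ω : Type*} [MeasurableSpace Ω] {P : Measure Ω}
    [IsProbabilityMeasure P] {n : ℕ} {X Y : Ω → Fin n → ℝ} (hmX : Measurable X) (hmY : Measurable Y)
    (hind : IndepFun X Y P) [HasPDF X P volume] [HasPDF Y P volume] :
    P.map (fun ω ↦ (X ω, Y ω)) =
      (volume.prod volume).withDensity fun p ↦ pdf X P volume p.1 * pdf Y P volume p.2 := by
  rw [(indepFun_iff_map_prod_eq_prod_map_map hmX.aemeasurable hmY.aemeasurable).1 hind,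
    map_eq_withDensity_pdf X P volume, map_eq_withDensity_pdf Y P volume,
    prod_withDensity (measurable_pdf X P volume) (measurable_pdf Y P volume)]

theorem integral_pdf_mul_log_le {Ω : Type*} [MeasurableSpace Ω] {P : Measure Ω}
    [IsProbabilityMeasure P] {n : ℕ} {c s : ℝ} (hc : 0 ≤ c) (hs : 0 ≤ s)
    (hcs : c ^ 2 + s ^ 2 = 1) {X Y : Ω → Fin n → ℝ} (hmX : Measurable X) (hmY : Measurable Y)
    (hind : IndepFun X Y P) [HasPDF X P volume] [HasPDF Y P volume]
    [HasPDF (fun ω ↦ c • X ω + s • Y ω) P volume]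
    (hX : Integrable fun x ↦ (pdf X P volume x).toReal * Real.log (pdf X P volume x).toReal)
    (hY : Integrable fun x ↦ (pdf Y P volume x).toReal * Real.log (pdf Y P volume x).toReal)
    (hZ : Integrable fun x ↦ (pdf (fun ω ↦ c • X ω + s • Y ω) P volume x).toReal *
      Real.log (pdf (fun ω ↦ c • X ω + s • Y ω) P volume x).toReal) :
    ∫ x, (pdf (fun ω ↦ c • X ω + s • Y ω) P volume x).toReal *
        Real.log (pdf (fun ω ↦ c • X ω + s • Y ω) P volume x).toReal
      ≤ c ^ 2 * (∫ x, (pdf X P volume x).toReal * Real.log (pdf X P volume x).toReal)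
        + s ^ 2 * ∫ x, (pdf Y P volume x).toReal * Real.log (pdf Y P volume x).toReal := by
  set Z : Ω → Fin n → ℝ := fun ω ↦ c • X ω + s • Y ω with hZdef
  have one : ∀ (W : Ω → Fin n → ℝ) [HasPDF W P volume],
      Integrable (fun x ↦ (pdf W P volume x).toReal) ∧ ∫ x, (pdf W P volume x).toReal = 1 := by
    intro W _
    have h1 : ∫⁻ x, pdf W P volume x = 1 := by
      rw [pdf.lintegral_eq_measure_univ, measure_univ]
    have hm := (measurable_pdf W P volume).aemeasurable (μ := volume)
    refine ⟨integrable_toReal_of_lintegral_ne_top hm (by rw [h1]; exact ENNReal.one_ne_top), ?_⟩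
    rw [integral_toReal hm pdf.ae_lt_top, h1, ENNReal.toReal_one]
  set g : (Fin n → ℝ) → ℝ := fun z ↦ (pdf Z P volume z).toReal with hgdef
  have hg : Measurable g := (measurable_pdf Z P volume).ennreal_toReal
  set m : (Fin n → ℝ) × (Fin n → ℝ) → Fin n → ℝ := fun p ↦ c • p.1 + s • p.2 with hmdef
  have hm : Measurable m := by fun_prop
  set ρ : (Fin n → ℝ) × (Fin n → ℝ) → ENNReal :=
    fun p ↦ pdf X P volume p.1 * pdf Y P volume p.2 with hρdef
  have hρ : Measurable ρ := ((measurable_pdf X P volume).comp measurable_fst).mul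
    ((measurable_pdf Y P volume).comp measurable_snd)
  have hρtop : ∀ᵐ p ∂(volume.prod volume), ρ p < ⊤ := by
    filter_upwards [
      Measure.quasiMeasurePreserving_fst.ae
        (show ∀ᵐ x, pdf X P volume x < ⊤ from pdf.ae_lt_top),
      Measure.quasiMeasurePreserving_snd.ae
        (show ∀ᵐ x, pdf Y P volume x < ⊤ from pdf.ae_lt_top)] with p h1 h2
    exact ENNReal.mul_lt_top h1 h2
  have hlaw : volume.withDensity (pdf Z P volume) =
      ((volume.prod volume).withDensity ρ).map m := by
    rw [← map_eq_withDensity_pdf Z P volume, ← map_prod_eq_withDensity_pdf hmX hmY hind,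
      Measure.map_map hm (hmX.prodMk hmY)]
    rfl
  have hZi : Integrable (fun z ↦ Real.log (g z)) (volume.withDensity (pdf Z P volume)) :=
    (integrable_withDensity_iff_integrable_smul' (measurable_pdf Z P volume) pdf.ae_lt_top).2 hZ
  have hsm : ∀ p, (ρ p).toReal • Real.log (g (m p)) = (pdf X P volume p.1).toReal *
      (pdf Y P volume p.2).toReal * Real.log (g (m p)) := fun p ↦ by
    rw [hρdef, ENNReal.toReal_mul, smul_eq_mul]
  have hZlaw : ∫ z, g z * Real.log (g z) = ∫ p, (pdf X P volume p.1).toReal *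
      (pdf Y P volume p.2).toReal * Real.log (g (m p)) ∂(volume.prod volume) := by
    have h1 := integral_withDensity_eq_integral_toReal_smul (measurable_pdf Z P volume)
      pdf.ae_lt_top fun z ↦ Real.log (g z)
    simp only [smul_eq_mul] at h1
    rw [← h1, hlaw, integral_map hm.aemeasurable hg.log.aestronglyMeasurable,
      integral_withDensity_eq_integral_toReal_smul hρ hρtop]
    simp only [hsm]
  have hL : Integrable (fun p : (Fin n → ℝ) × (Fin n → ℝ) ↦ (pdf X P volume p.1).toReal *
      (pdf Y P volume p.2).toReal * Real.log (g (m p))) (volume.prod volume) := by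
    rw [hlaw, integrable_map_measure hg.log.aestronglyMeasurable hm.aemeasurable] at hZi
    have := (integrable_withDensity_iff_integrable_smul' hρ hρtop).1 hZi
    simpa only [Function.comp_apply, hsm] using this
  have hpos : ∀ᵐ p ∂(volume.prod volume), (pdf X P volume p.1).toReal *
      (pdf Y P volume p.2).toReal ≠ 0 → 0 < g (m p) := by
    have h1 : ∀ᵐ z ∂(volume.withDensity (pdf Z P volume)), 0 < g z := by
      rw [ae_withDensity_iff (measurable_pdf Z P volume)]
      filter_upwards [show ∀ᵐ x, pdf Z P volume x < ⊤ from pdf.ae_lt_top] with z hz hz0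
      exact ENNReal.toReal_pos hz0 hz.ne
    rw [hlaw] at h1
    have h2 := (ae_withDensity_iff hρ).1 (ae_of_ae_map hm.aemeasurable h1)
    filter_upwards [h2] with p hp h0
    refine hp fun h ↦ h0 ?_
    rw [← ENNReal.toReal_mul]
    exact (congrArg ENNReal.toReal h).trans ENNReal.toReal_zero
  rw [hZlaw]
  exact integral_prod_mul_log_le hc hs hcs (measurable_pdf X P volume).ennreal_toReal
    (measurable_pdf Y P volume).ennreal_toReal hg (fun _ ↦ ENNReal.toReal_nonneg)
    (fun _ ↦ ENNReal.toReal_nonneg) (fun _ ↦ ENNReal.toReal_nonneg) (one X).1 (one Y).1 (one Z).1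
    (one X).2 (one Y).2 (one Z).2 hX hY hL hpos

end

/-- **Entropy power inequality, Lieb form (Eq. (3) of the paper).**  For `n ≥ 1`,
`λ ∈ [0,1]`, and independent `ℝⁿ`-valued random vectors `X`, `Y`, each with a density
w.r.t. Lebesgue measure and finite differential entropy, if `√λ·X + √(1-λ)·Y` has finite
differential entropy then `H(√λ·X + √(1-λ)·Y) ≥ λ·H(X) + (1-λ)·H(Y)`. -/
theorem entropy_power_inequality_lieb
    {Ω : Type*} [MeasureSpace Ω] [IsProbabilityMeasure (ℙ : Measure Ω)]
    (n : ℕ) (hn : 1 ≤ n) (l : ℝ) (hl : l ∈ Set.Icc (0 : ℝ) 1)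
    (X Y : Ω → (Fin n → ℝ)) (hmX : Measurable X) (hmY : Measurable Y)
    (hind : IndepFun X Y ℙ)
    [MeasureTheory.HasPDF X ℙ volume] [MeasureTheory.HasPDF Y ℙ volume]
    [MeasureTheory.HasPDF
      (fun ω => Real.sqrt l • X ω + Real.sqrt (1 - l) • Y ω) ℙ volume]
    (hX : Integrable (fun x => (MeasureTheory.pdf X ℙ volume x).toReal *
        Real.log ((MeasureTheory.pdf X ℙ volume x).toReal)) volume)
    (hY : Integrable (fun x => (MeasureTheory.pdf Y ℙ volume x).toReal *
        Real.log ((MeasureTheory.pdf Y ℙ volume x).toReal)) volume)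
    (hZ : Integrable (fun x =>
        (MeasureTheory.pdf
          (fun ω => Real.sqrt l • X ω + Real.sqrt (1 - l) • Y ω) ℙ volume x).toReal *
        Real.log ((MeasureTheory.pdf
          (fun ω => Real.sqrt l • X ω + Real.sqrt (1 - l) • Y ω) ℙ volume x).toReal)) volume) :
    diffEntropy (fun ω => Real.sqrt l • X ω + Real.sqrt (1 - l) • Y ω) ≥
      l * diffEntropy X + (1 - l) * diffEntropy Y := by
  have hc : Real.sqrt l ^ 2 = l := Real.sq_sqrt hl.1
  have hs : Real.sqrt (1 - l) ^ 2 = 1 - l := Real.sq_sqrt (sub_nonneg.2 hl.2)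
  have key := integral_pdf_mul_log_le (Real.sqrt_nonneg l) (Real.sqrt_nonneg (1 - l))
    (by rw [hc, hs]; ring) hmX hmY hind hX hY hZ
  rw [hc, hs] at key
  unfold diffEntropy
  linarith
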